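/- arXiv:1407.6232 — 2 statements merged into one kernel-verified Lean document; each statement's English description precedes it below -/
import Mathlib

section
/- Let N ≥ 5 be an integer and let β̄ > 0, γ̄ ≥ 0 and m > 0 be real numbers. Define, for x ∈ [0,1], g(x) := β̄·x^{(N−2)/N} + m·(1−x)^{(N−2)/N}, f(x) := γ̄·x^{(N−1)/N} + √( γ̄²·x^{2(N−1)/N} + 4·g(x) ), and h(x) := f(x)^N + (4N/(N−2))·f(x)^{N−2}·g(x). Then the minimum of h over [0,1] is attained at an endpoint, i.e. min_{x∈[0,1]} h(x) = min(h(0), h(1)). -/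
open Real

/-- Weighted power inequality: `n r^((n-k)/n) ≤ (n-k) r + k`. -/
lemma aux_bern (n k r : ℝ) (hn : 0 < n) (hk : 0 ≤ k) (hkn : k ≤ n) (hr : 0 ≤ r) :
    n * r ^ ((n - k) / n) ≤ (n - k) * r + k := by
  have h := rpow_one_add_le_one_add_mul_self (s := r - 1) (by linarith)
    (p := (n - k) / n) (div_nonneg (by linarith) hn.le) (by rw [div_le_one hn]; linarith)
  rw [show 1 + (r - 1) = r by ring] at h
  have h2 := mul_le_mul_of_nonneg_left h hn.le
  have h3 : n * (1 + (n - k) / n * (r - 1)) = (n - k) * r + k := by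
    field_simp
    ring
  linarith

/-- The auxiliary one-parameter energy. -/
lemma aux_core (n G A f : ℝ) (hn : 5 ≤ n) (hG : 0 < G) (hA : 0 ≤ A) (hf : 0 < f)
    (hq : f ^ 2 = 2 * A * f + 4 * G) :
    (∀ s : ℝ, 0 ≤ s → 4 * n * (n - 1) / (n - 2) * G * s ^ ((n - 2) / n)
        + 2 * n * A * s ^ ((n - 1) / n) - (n - 1) * s
        ≤ f ^ n + (4 * n / (n - 2)) * f ^ (n - 2) * G) ∧
    4 * n * (n - 1) / (n - 2) * G * (f ^ n) ^ ((n - 2) / n)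
        + 2 * n * A * (f ^ n) ^ ((n - 1) / n) - (n - 1) * f ^ n
        = f ^ n + (4 * n / (n - 2)) * f ^ (n - 2) * G := by
  have hn0 : n ≠ 0 := by linarith
  have hn2 : 0 < n - 2 := by linarith
  have hn2' : n - 2 ≠ 0 := hn2.ne'
  have e2 : (f ^ n) ^ ((n - 2) / n) = f ^ (n - 2) := by
    rw [← Real.rpow_mul hf.le]
    congr 1
    field_simp
  have e1 : (f ^ n) ^ ((n - 1) / n) = f ^ (n - 2) * f := by
    rw [← Real.rpow_mul hf.le, ← Real.rpow_add_one hf.ne']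
    congr 1
    field_simp
    ring
  have e0 : f ^ n = f ^ (n - 2) * f ^ 2 := by
    rw [← Real.rpow_add_natCast hf.ne']
    congr 1
    push_cast
    ring
  have hw : 0 < f ^ (n - 2) := Real.rpow_pos_of_pos hf _
  have hF : 0 < f ^ n := Real.rpow_pos_of_pos hf _
  constructor
  · intro s hs
    obtain ⟨r, hr, rfl⟩ : ∃ r, 0 ≤ r ∧ s = r * f ^ n :=
      ⟨s / f ^ n, by positivity, by field_simp⟩
    rw [Real.mul_rpow hr hF.le, Real.mul_rpow hr hF.le, e1, e2, e0]
    have b2 := aux_bern n 2 r (by linarith) (by norm_num) (by linarith) hr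
    have b1 := aux_bern n 1 r (by linarith) (by norm_num) (by linarith) hr
    generalize r ^ ((n - 2) / n) = P at *
    generalize r ^ ((n - 1) / n) = Q at *
    generalize f ^ (n - 2) = w at *
    have c2 : 0 ≤ 4 * (n - 1) / (n - 2) * G * w := by
      have : 0 < n - 1 := by linarith
      positivity
    have c1 : 0 ≤ 2 * A * w * f := by positivity
    have d2 := mul_le_mul_of_nonneg_left b2 c2
    have d1 := mul_le_mul_of_nonneg_left b1 c1
    have key : 4 * (n - 1) / (n - 2) * G * w * ((n - 2) * r + 2)
        + 2 * A * w * f * ((n - 1) * r + 1) - (n - 1) * (r * (w * f ^ 2))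
        = w * f ^ 2 + 4 * n / (n - 2) * w * G := by
      rw [hq]
      field_simp
      ring
    have l2 : 4 * n * (n - 1) / (n - 2) * G * (P * w)
        = 4 * (n - 1) / (n - 2) * G * w * (n * P) := by ring
    have l1 : 2 * n * A * (Q * (w * f)) = 2 * A * w * f * (n * Q) := by ring
    rw [l2, l1]
    linarith
  · rw [e1, e2, e0]
    generalize f ^ (n - 2) = w at *
    rw [hq]
    field_simp
    ring

/-- The one-variable claim in Lemma 3.1 of the paper: the function
`h(x) = f(x)^N + (4N/(N−2))·f(x)^(N−2)·g(x)`, with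
`g(x) = β̄·x^((N−2)/N) + m·(1−x)^((N−2)/N)` and
`f(x) = γ̄·x^((N−1)/N) + √(γ̄²·x^(2(N−1)/N) + 4g(x))`,
attains its minimum on `[0,1]` at an endpoint. -/
theorem stmt_6 (N : ℕ) (hN : 5 ≤ N) (β γ m : ℝ) (hβ : 0 < β) (hγ : 0 ≤ γ) (hm : 0 < m) :
    let g : ℝ → ℝ := fun x =>
      β * x ^ (((N : ℝ) - 2) / (N : ℝ)) + m * (1 - x) ^ (((N : ℝ) - 2) / (N : ℝ))
    let f : ℝ → ℝ := fun x =>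
      γ * x ^ (((N : ℝ) - 1) / (N : ℝ))
        + Real.sqrt (γ ^ 2 * x ^ (2 * ((N : ℝ) - 1) / (N : ℝ)) + 4 * g x)
    let h : ℝ → ℝ := fun x =>
      f x ^ (N : ℝ) + (4 * (N : ℝ) / ((N : ℝ) - 2)) * f x ^ ((N : ℝ) - 2) * g x
    IsLeast (h '' Set.Icc (0 : ℝ) 1) (min (h 0) (h 1)) := by
  intro g f h
  have hN5 : (5 : ℝ) ≤ (N : ℝ) := by exact_mod_cast hN
  have hN0 : (N : ℝ) ≠ 0 := by linarith
  set n : ℝ := (N : ℝ) with hn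
  have hn2 : 0 < n - 2 := by linarith
  have hn1 : 0 < n - 1 := by linarith
  have hnp : 0 < n := by linarith
  set p : ℝ := (n - 2) / n with hp
  set q : ℝ := (n - 1) / n with hqd
  have hp0 : 0 < p := by positivity
  have hq0 : 0 < q := by positivity
  have hp1 : p ≤ 1 := by rw [hp, div_le_one hnp]; linarith
  have hq1 : q ≤ 1 := by rw [hqd, div_le_one hnp]; linarith
  -- positivity of `g`
  have hg : ∀ x ∈ Set.Icc (0 : ℝ) 1, 0 < g x := by
    rintro x ⟨hx0, hx1⟩
    have h1x : 0 ≤ 1 - x := by linarith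
    change 0 < β * x ^ p + m * (1 - x) ^ p
    rcases hx0.eq_or_lt with h0 | h0
    · have : 0 < (1 - x) ^ p := Real.rpow_pos_of_pos (by linarith) _
      have : 0 ≤ x ^ p := Real.rpow_nonneg hx0 _
      positivity
    · have : 0 < x ^ p := Real.rpow_pos_of_pos h0 _
      have : 0 ≤ (1 - x) ^ p := Real.rpow_nonneg h1x _
      positivity
  -- the quadratic equation for `f`
  have hf : ∀ x ∈ Set.Icc (0 : ℝ) 1, 0 < f x ∧
      (f x) ^ 2 = 2 * (γ * x ^ q) * f x + 4 * g x := by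
    intro x hx
    have hgx := hg x hx
    have ha : 0 ≤ x ^ q := Real.rpow_nonneg hx.1 _
    have e : x ^ (2 * (n - 1) / n) = (x ^ q) ^ 2 := by
      rw [← Real.rpow_mul_natCast hx.1]
      congr 1
      rw [hqd]
      push_cast
      ring
    have hfx : f x = γ * x ^ q + Real.sqrt (γ ^ 2 * (x ^ q) ^ 2 + 4 * g x) := by
      rw [← e]
    have hpos : 0 < γ ^ 2 * (x ^ q) ^ 2 + 4 * g x := by positivity
    have hs := Real.sq_sqrt hpos.le
    have hs0 := Real.sqrt_pos.2 hpos
    rw [hfx]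
    generalize Real.sqrt (γ ^ 2 * (x ^ q) ^ 2 + 4 * g x) = t at *
    refine ⟨by positivity, ?_⟩
    nlinarith
  let Φ : ℝ → ℝ → ℝ := fun y z =>
    4 * n * (n - 1) / (n - 2) * (β * y ^ p + m * z ^ p) + 2 * n * γ * y ^ q - (n - 1) * (y + z)
  have hΦ : ∀ x ∈ Set.Icc (0 : ℝ) 1, ∀ s : ℝ, 0 ≤ s → Φ (x * s) ((1 - x) * s) =
      4 * n * (n - 1) / (n - 2) * g x * s ^ p + 2 * n * (γ * x ^ q) * s ^ q - (n - 1) * s := by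
    rintro x ⟨hx0, hx1⟩ s hs
    have h1x : 0 ≤ 1 - x := by linarith
    change 4 * n * (n - 1) / (n - 2) * (β * (x * s) ^ p + m * ((1 - x) * s) ^ p)
      + 2 * n * γ * (x * s) ^ q - (n - 1) * (x * s + (1 - x) * s) =
      4 * n * (n - 1) / (n - 2) * (β * x ^ p + m * (1 - x) ^ p) * s ^ p
        + 2 * n * (γ * x ^ q) * s ^ q - (n - 1) * s
    rw [Real.mul_rpow hx0 hs, Real.mul_rpow h1x hs, Real.mul_rpow hx0 hs]
    ring
  have hge : ∀ x ∈ Set.Icc (0 : ℝ) 1, ∀ s : ℝ, 0 ≤ s → Φ (x * s) ((1 - x) * s) ≤ h x := by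
    intro x hx s hs
    rw [hΦ x hx s hs]
    exact (aux_core n (g x) (γ * x ^ q) (f x) hN5 (hg x hx)
      (mul_nonneg hγ (Real.rpow_nonneg hx.1 _)) (hf x hx).1 (hf x hx).2).1 s hs
  have heq : ∀ x ∈ Set.Icc (0 : ℝ) 1, ∃ s : ℝ, 0 < s ∧ Φ (x * s) ((1 - x) * s) = h x := by
    intro x hx
    have hF : 0 < f x ^ n := Real.rpow_pos_of_pos (hf x hx).1 _
    refine ⟨f x ^ n, hF, ?_⟩
    rw [hΦ x hx _ hF.le]
    exact (aux_core n (g x) (γ * x ^ q) (f x) hN5 (hg x hx)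
      (mul_nonneg hγ (Real.rpow_nonneg hx.1 _)) (hf x hx).1 (hf x hx).2).2
  have m0 : (0 : ℝ) ∈ Set.Icc (0 : ℝ) 1 := by simp
  have m1 : (1 : ℝ) ∈ Set.Icc (0 : ℝ) 1 := by simp
  constructor
  · rcases min_choice (h 0) (h 1) with e | e
    · rw [e]; exact ⟨0, m0, rfl⟩
    · rw [e]; exact ⟨1, m1, rfl⟩
  · rintro _ ⟨x, hx, rfl⟩
    obtain ⟨s₀, hs₀, e₀⟩ := heq 0 m0
    obtain ⟨s₁, hs₁, e₁⟩ := heq 1 m1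
    have hx0 := hx.1
    have h1x : 0 ≤ 1 - x := by linarith [hx.2]
    have hD : 0 < x * s₀ + (1 - x) * s₁ := by
      rcases hx0.eq_or_lt with h0 | h0
      · rw [← h0]; linarith
      · have := mul_pos h0 hs₀
        have := mul_nonneg h1x hs₁.le
        linarith
    set D := x * s₀ + (1 - x) * s₁ with hDd
    -- the weights of the convex combination
    set a := x * s₀ / D with ha
    set b := (1 - x) * s₁ / D with hb
    have ha0 : 0 ≤ a := by positivity
    have hb0 : 0 ≤ b := by positivity
    have hab : a + b = 1 := by
      rw [ha, hb, ← add_div, ← hDd, div_self hD.ne']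
    have hy : x * (s₀ * s₁ / D) = a * s₁ := by rw [ha]; ring
    have hz : (1 - x) * (s₀ * s₁ / D) = b * s₀ := by rw [hb]; ring
    have h1 := hge x hx (s₀ * s₁ / D) (by positivity)
    rw [hy, hz] at h1
    refine le_trans ?_ h1
    have conc : ∀ r c s : ℝ, 0 < r → r ≤ 1 → 0 ≤ c → c ≤ 1 → 0 ≤ s →
        c * s ^ r ≤ (c * s) ^ r := by
      intro r c s hr hr1 hc hc1 hs
      rw [Real.mul_rpow hc hs]
      refine mul_le_mul_of_nonneg_right ?_ (Real.rpow_nonneg hs _)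
      rcases hc.eq_or_lt with h0 | h0
      · rw [← h0, Real.zero_rpow hr.ne']
      · simpa using Real.rpow_le_rpow_of_exponent_ge h0 hc1 hr1
    have k1 := conc p a s₁ hp0 hp1 ha0 (by linarith) hs₁.le
    have k2 := conc p b s₀ hp0 hp1 hb0 (by linarith) hs₀.le
    have k3 := conc q a s₁ hq0 hq1 ha0 (by linarith) hs₁.le
    have f0 : h 0 = 4 * n * (n - 1) / (n - 2) * (m * s₀ ^ p) - (n - 1) * s₀ := by
      rw [← e₀]
      simp [Φ, Real.zero_rpow hp0.ne', Real.zero_rpow hq0.ne']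
    have f1 : h 1 = 4 * n * (n - 1) / (n - 2) * (β * s₁ ^ p) + 2 * n * γ * s₁ ^ q
        - (n - 1) * s₁ := by
      rw [← e₁]
      simp [Φ, Real.zero_rpow hp0.ne']
    have hC : 0 ≤ 4 * n * (n - 1) / (n - 2) := by positivity
    have hcomb : a * h 1 + b * h 0 ≤ Φ (a * s₁) (b * s₀) := by
      change _ ≤ 4 * n * (n - 1) / (n - 2) * (β * (a * s₁) ^ p + m * (b * s₀) ^ p)
        + 2 * n * γ * (a * s₁) ^ q - (n - 1) * (a * s₁ + b * s₀)
      rw [f0, f1]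
      have j1 := mul_le_mul_of_nonneg_left k1 (mul_nonneg hC hβ.le)
      have j2 := mul_le_mul_of_nonneg_left k2 (mul_nonneg hC hm.le)
      have j3 := mul_le_mul_of_nonneg_left k3 (show 0 ≤ 2 * n * γ by positivity)
      generalize 4 * n * (n - 1) / (n - 2) = C at *
      linarith
    refine le_trans ?_ hcomb
    have i1 := mul_le_mul_of_nonneg_left (min_le_right (h 0) (h 1)) ha0
    have i0 := mul_le_mul_of_nonneg_left (min_le_left (h 0) (h 1)) hb0
    calc min (h 0) (h 1) = a * min (h 0) (h 1) + b * min (h 0) (h 1) := by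
          rw [← add_mul, hab, one_mul]
      _ ≤ _ := add_le_add i1 i0
end

section
/- Let N ≥ 3 be an integer, let Ω ⊂ ℝ^N be a bounded measurable set, and let q be a real number with 1 ≤ q < N/(N−2). Then there exists a constant c₂ > 0 (depending only on N, q and Ω) such that for every ε ∈ (0,1] and every y ∈ ℝ^N, ∫_Ω U_{ε,y}(x)^q dx ≤ c₂ · ε^{q(N−2)/2}. -/
open Real MeasureTheory

/-- The Talenti instanton `U(x) = (N(N−2)/(N(N−2)+|x|²))^((N−2)/2)` on `ℝ^N`. -/
noncomputable def talenti (N : ℕ) (x : EuclideanSpace ℝ (Fin N)) : ℝ :=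
  ((N : ℝ) * ((N : ℝ) - 2) / ((N : ℝ) * ((N : ℝ) - 2) + ‖x‖ ^ 2)) ^ (((N : ℝ) - 2) / 2)

/-- The rescaled instanton `U_{ε,y}(x) = ε^(−(N−2)/2)·U((x−y)/ε)`. -/
noncomputable def talentiRescaled (N : ℕ) (ε : ℝ) (y x : EuclideanSpace ℝ (Fin N)) : ℝ :=
  ε ^ (-(((N : ℝ) - 2) / 2)) * talenti N (ε⁻¹ • (x - y))

/-- Brézis–Nirenberg estimate (upper bound in (4.2) of the paper): for `1 ≤ q < N/(N−2)`
there is `c₂ > 0` with `∫_Ω U_{ε,y}^q ≤ c₂·ε^(q(N−2)/2)` for all `ε ∈ (0,1]`, `y ∈ ℝ^N`. -/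
theorem stmt_13 (N : ℕ) (hN : 3 ≤ N) (Ω : Set (EuclideanSpace ℝ (Fin N)))
    (hΩb : Bornology.IsBounded Ω) (hΩm : MeasurableSet Ω)
    (q : ℝ) (hq1 : 1 ≤ q) (hq2 : q < (N : ℝ) / ((N : ℝ) - 2)) :
    ∃ c₂ > (0 : ℝ), ∀ ε ∈ Set.Ioc (0 : ℝ) 1, ∀ y : EuclideanSpace ℝ (Fin N),
      ∫ x in Ω, talentiRescaled N ε y x ^ q ≤ c₂ * ε ^ (q * ((N : ℝ) - 2) / 2) := by
  have hN' : (3:ℝ) ≤ N := by exact_mod_cast hN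
  have : NeZero N := ⟨by omega⟩
  obtain ⟨a, ha⟩ : ∃ a : ℝ, a = ((N:ℝ) - 2) / 2 := ⟨_, rfl⟩
  obtain ⟨K, hK⟩ : ∃ K : ℝ, K = (N:ℝ) * ((N:ℝ) - 2) := ⟨_, rfl⟩
  have ha0 : 0 < a := by rw [ha]; linarith
  have hK0 : 0 < K := by rw [hK]; apply mul_pos <;> linarith
  have hq0 : 0 < q := by linarith
  have hs : q * (2 * a) < N := by
    rw [lt_div_iff₀ (by linarith)] at hq2
    rw [ha]; linarith
  let g : EuclideanSpace ℝ (Fin N) → ℝ := fun z => ‖z‖ ^ (-(q * (2 * a)))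
  have hg0 : ∀ z, 0 ≤ g z := fun z => Real.rpow_nonneg (norm_nonneg _) _
  have hgm : Measurable g := by fun_prop
  have hgi : IntegrableOn g (Metric.ball 0 1) := by
    refine integrableOn_ball_of_norm_le_rpow (C := 1) (α := q * (2 * a)) (by simp; omega) (by simpa using hs) ?_ hgm.aestronglyMeasurable
    refine Filter.Eventually.of_forall fun z => ?_
    rw [Real.norm_of_nonneg (hg0 z), one_mul]
  let h : EuclideanSpace ℝ (Fin N) → ℝ := (Metric.ball 0 1).indicator g
  have hh0 : ∀ z, 0 ≤ h z := fun z => Set.indicator_nonneg (fun z _ => hg0 z) z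
  have hhi : Integrable h := (integrable_indicator_iff measurableSet_ball).2 hgi
  have hgh : ∀ z, g z ≤ 1 + h z := by
    intro z
    by_cases hz : z ∈ Metric.ball (0 : EuclideanSpace ℝ (Fin N)) 1
    · simp [h, Set.indicator_of_mem hz]
    · simp only [h, Set.indicator_of_notMem hz, add_zero]
      simp at hz
      exact Real.rpow_le_one_of_one_le_of_nonpos hz (by have := mul_pos hq0 ha0; linarith)
  have hI0 : 0 ≤ ∫ z, h z := integral_nonneg hh0
  have hfin : volume Ω ≠ ⊤ := hΩb.measure_lt_top.ne
  refine ⟨K ^ (a * q) * (volume.real Ω + ∫ z, h z) + 1, by positivity, ?_⟩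
  rintro ε ⟨hε, -⟩ y
  have hexp : q * ((N:ℝ) - 2) / 2 = a * q := by rw [ha]; ring
  rw [hexp]
  have hT : ∀ x, talentiRescaled N ε y x = (K * ε / (K * ε ^ 2 + ‖x - y‖ ^ 2)) ^ a := by
    intro x
    unfold talentiRescaled talenti
    rw [← hK, ← ha, Real.rpow_neg hε.le, ← Real.inv_rpow hε.le, ← Real.mul_rpow (by positivity) (by positivity)]
    congr 1
    rw [norm_smul, norm_inv, Real.norm_of_nonneg hε.le]
    field_simp
  have hpt : ∀ x, x ≠ y → talentiRescaled N ε y x ^ q ≤ (K ^ (a * q) * ε ^ (a * q)) * (1 + h (x - y)) := by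
    intro x hx
    have hr : 0 < ‖x - y‖ := norm_pos_iff.2 (sub_ne_zero.2 hx)
    rw [hT, ← Real.rpow_mul (by positivity)]
    calc _ ≤ (K * ε / ‖x - y‖ ^ 2) ^ (a * q) := by
          apply Real.rpow_le_rpow (by positivity) _ (by positivity)
          apply div_le_div_of_nonneg_left (by positivity) (by positivity)
          have : 0 < K * ε ^ 2 := by positivity
          linarith
      _ = (K ^ (a * q) * ε ^ (a * q)) * g (x - y) := by
          rw [Real.div_rpow (by positivity) (by positivity), Real.mul_rpow hK0.le hε.le, div_eq_mul_inv]
          congr 1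
          simp only [g]
          rw [Real.rpow_neg hr.le, ← Real.rpow_natCast, ← Real.rpow_mul hr.le]
          congr 2
          push_cast
          ring
      _ ≤ _ := by
          apply mul_le_mul_of_nonneg_left (hgh _) (by positivity)
  have hhy : Integrable (fun x => h (x - y)) := hhi.comp_sub_right y
  have h1 : IntegrableOn (fun _ : EuclideanSpace ℝ (Fin N) => (1:ℝ)) Ω := integrableOn_const hfin
  have hsum : IntegrableOn (fun x => 1 + h (x - y)) Ω := h1.add hhy.integrableOn
  have hae : ∀ᵐ x ∂(volume.restrict Ω), x ≠ y := by
    apply ae_restrict_of_ae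
    have : Nonempty (Fin N) := ⟨0⟩
    exact Measure.ae_ne volume y
  calc ∫ x in Ω, talentiRescaled N ε y x ^ q
      ≤ ∫ x in Ω, (K ^ (a * q) * ε ^ (a * q)) * (1 + h (x - y)) := by
        apply integral_mono_of_nonneg
        · refine Filter.Eventually.of_forall fun x => ?_
          simp only [hT, Pi.zero_apply]
          positivity
        · exact hsum.const_mul _
        · filter_upwards [hae] with x hx using hpt x hx
    _ = (K ^ (a * q) * ε ^ (a * q)) * (volume.real Ω + ∫ x in Ω, h (x - y)) := by
        rw [integral_const_mul, integral_add h1 hhy.integrableOn]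
        simp
    _ ≤ (K ^ (a * q) * ε ^ (a * q)) * (volume.real Ω + ∫ x, h x) := by
        gcongr
        rw [← integral_sub_right_eq_self h y]
        exact setIntegral_le_integral hhy (Filter.Eventually.of_forall fun x => hh0 _)
    _ ≤ _ := by
        have : 0 < ε ^ (a * q) := by positivity
        linarith
end
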